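/- arXiv:1711.10664 — 2 statements merged into one kernel-verified Lean document; each statement's English description precedes it below -/
import Mathlib

section
/- Let k be an algebraically closed field and s ≥ 2 an integer, and let Λ = T(V)/(Rel) be an s-homogeneous k-algebra. If dim_k Λ_s = 2, then dim_k Λ_{2s} ≤ 2. (Equivalently: if the s-th Veronese ring of an s-homogeneous algebra has exactly two generators, then it has at least two quadratic relations.) -/
/-! Core definitions for s-homogeneous algebras Λ = T(V)/(Rel). -/

open TensorAlgebra Submodule Module
open scoped TensorProduct

noncomputable section

namespace SHomog

variable (k : Type) [Field k] (V : Type) [AddCommGroup V] [Module k V]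

/-- The degree-`n` component `V^{⊗n}` of the tensor algebra `T(V)`, realized as the
`n`-th power of the subspace `ι(V) ⊆ T(V)`. -/
def gpc (n : ℕ) : Submodule k (TensorAlgebra k V) :=
  (LinearMap.range (TensorAlgebra.ι k (M := V))) ^ n

variable {k V}
variable (Rel : Submodule k (TensorAlgebra k V)) (s : ℕ)

/-- `I_n = Σ_{i+s+j=n} V^{⊗i} ⊗ Rel ⊗ V^{⊗j}` (as a subspace of `V^{⊗n} ⊆ T(V)`). -/
def Ideg (n : ℕ) : Submodule k (TensorAlgebra k V) :=
  ⨆ p : {p : ℕ × ℕ // p.1 + s + p.2 = n}, gpc k V p.1.1 * Rel * gpc k V p.1.2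

/-- `R_n = ∩_{i+s+j=n} V^{⊗i} ⊗ Rel ⊗ V^{⊗j}` for `n ≥ s`, and `R_n = V^{⊗n}` for `n < s`. -/
def Rdeg (n : ℕ) : Submodule k (TensorAlgebra k V) :=
  if n < s then gpc k V n
  else ⨅ p : {p : ℕ × ℕ // p.1 + s + p.2 = n}, gpc k V p.1.1 * Rel * gpc k V p.1.2

/-- The `s`-homogeneous algebra `Λ = T(V)/(Rel)`: the quotient of the tensor algebra by the
two-sided ideal generated by `Rel`. -/
abbrev quotAlg := RingQuot (fun x y : TensorAlgebra k V => x ∈ Rel ∧ y = 0)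

/-- The quotient map `T(V) → Λ`. -/
def qmap : TensorAlgebra k V →ₐ[k] quotAlg Rel :=
  RingQuot.mkAlgHom k _

/-- The degree-`n` homogeneous component `Λ_n = V^{⊗n}/I_n` of `Λ`, realized as the image of
`V^{⊗n}` in the quotient. -/
def Adeg (n : ℕ) : Submodule k (quotAlg Rel) :=
  (gpc k V n).map (qmap Rel).toLinearMap

/-- The Hilbert series `H_Λ(t) = Σ_n (dim_k Λ_n) tⁿ ∈ ℤ[[t]]`. -/
def hilb : PowerSeries ℤ :=
  PowerSeries.mk fun n => (Module.finrank k (Adeg Rel n) : ℤ)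

/-- The extra condition: `Rel ⊗ V^{⊗(s-1)} ∩ V ⊗ I_{2s-2} = R_{s+1} ⊗ V^{⊗(s-2)}`
inside `V^{⊗(2s-1)}`. -/
def ExtraCond : Prop :=
  Rel * gpc k V (s - 1) ⊓ gpc k V 1 * Ideg Rel s (2 * s - 2)
    = Rdeg Rel s (s + 1) * gpc k V (s - 2)

end SHomog

open SHomog Module

namespace SHomogAux

section Core

variable {k : Type} [Field k] {L : Type}

/-- Rotation of functions on words: `(rot f) w = f (w.rotate 1)`. -/
def rot : (List L → k) →ₗ[k] (List L → k) :=
  LinearMap.funLeft k k (fun w : List L => w.rotate 1)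

lemma rot_cons (f : List L → k) (x : L) (m : List L) :
    rot f (x :: m) = f (m ++ [x]) := by
  simp [rot, LinearMap.funLeft_apply]

lemma rot_nil (f : List L → k) : rot f [] = f [] := by
  simp [rot, LinearMap.funLeft_apply]

lemma rot_inj : Function.Injective (rot : (List L → k) →ₗ[k] (List L → k)) := by
  intro f g h
  funext w
  rcases List.eq_nil_or_concat w with rfl | ⟨m, x, rfl⟩
  · have := congrFun h []
    simpa [rot_nil] using this
  · have := congrFun h (x :: m)
    simpa [rot_cons] using this

/-- The compatibility of a pair `a ⊗ b` with all windows of length `s`. -/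
def Pair (W : Submodule k (List L → k)) (s : ℕ) (a b : List L → k) : Prop :=
  ∀ p q : List L, p.length + q.length = s → ∃ g ∈ W, ∀ m n : List L,
    m.length = q.length → n.length = p.length → g (m ++ n) = a (p ++ m) * b (n ++ q)

variable (W : Submodule k (List L → k)) (s : ℕ)

lemma le_map_iff (hdim : Module.finrank k W = 2) :
    W ≤ W.map rot ↔ W.map rot ≤ W := by
  have : FiniteDimensional k W := FiniteDimensional.of_finrank_pos (by omega)
  have e : Module.finrank k (W.map rot) = Module.finrank k W :=
    (Submodule.equivMapOfInjective rot rot_inj W).finrank_eq.symm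
  constructor
  · intro h
    exact (Submodule.eq_of_le_of_finrank_eq h e.symm).ge
  · intro h
    exact (Submodule.eq_of_le_of_finrank_eq h e).ge

lemma ex_ker (hdim : Module.finrank k W = 2) (w : List L) :
    ∃ f ∈ W, f ≠ 0 ∧ f w = 0 := by
  by_contra hcon
  push Not at hcon
  have : FiniteDimensional k W := FiniteDimensional.of_finrank_pos (by omega)
  have : Function.Injective ((LinearMap.proj w : (List L → k) →ₗ[k] k).domRestrict W) := by
    rw [injective_iff_map_eq_zero]
    intro f hf
    by_contra hne
    exact hcon f.1 f.2 (by simpa using hne) (by simpa using hf)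
  have := LinearMap.finrank_le_finrank_of_injective this
  simp [hdim] at this

lemma span_two (hdim : Module.finrank k W = 2) (f g : List L → k) (hf : f ∈ W) (hg : g ∈ W)
    (u v : List L) (huv : f u * g v ≠ f v * g u) (h : List L → k) (hh : h ∈ W) :
    ∃ c d : k, h = c • f + d • g := by
  have : FiniteDimensional k W := FiniteDimensional.of_finrank_pos (by omega)
  have hli : LinearIndependent k ![(⟨f, hf⟩ : W), ⟨g, hg⟩] := by
    rw [LinearIndependent.pair_iff]
    intro c d hcd
    have h1 : c • f + d • g = 0 := by simpa using congrArg Subtype.val hcd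
    have h2 := congrFun h1 u
    have h3 := congrFun h1 v
    simp only [Pi.add_apply, Pi.smul_apply, smul_eq_mul, Pi.zero_apply] at h2 h3
    have hne : f u * g v - f v * g u ≠ 0 := sub_ne_zero.mpr huv
    constructor
    · have : c * (f u * g v - f v * g u) = 0 := by linear_combination g v * h2 - g u * h3
      exact (mul_eq_zero.mp this).resolve_right hne
    · have : d * (f u * g v - f v * g u) = 0 := by linear_combination f u * h3 - f v * h2
      exact (mul_eq_zero.mp this).resolve_right hne
  have htop := hli.span_eq_top_of_card_eq_finrank (by simp [hdim])
  have hm : (⟨h, hh⟩ : W) ∈ Submodule.span k (Set.range ![(⟨f, hf⟩ : W), ⟨g, hg⟩]) := by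
    rw [htop]; trivial
  simp only [Matrix.range_cons, Matrix.range_empty, Set.union_empty, Set.singleton_union] at hm
  obtain ⟨c, d, hcd⟩ := Submodule.mem_span_pair.mp hm
  exact ⟨c, d, by simpa using (congrArg Subtype.val hcd).symm⟩

lemma ex_indep (hdim : Module.finrank k W = 2) :
    ∃ f ∈ W, ∃ g ∈ W, ∃ u v : List L, f u * g v ≠ f v * g u := by
  obtain ⟨f, hf, hf0, -⟩ := ex_ker W hdim []
  obtain ⟨u, hu⟩ := Function.ne_iff.mp hf0
  obtain ⟨g, hg, hg0, hgu⟩ := ex_ker W hdim u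
  obtain ⟨v, hv⟩ := Function.ne_iff.mp hg0
  refine ⟨f, hf, g, hg, u, v, ?_⟩
  rw [hgu, mul_zero]
  exact mul_ne_zero hu hv

variable {W s}

lemma ex_cons (hs : 2 ≤ s) (hsupp : ∀ f ∈ W, ∀ w : List L, w.length ≠ s → f w = 0)
    {f : List L → k} (hf : f ∈ W) (h0 : f ≠ 0) :
    ∃ x m, m.length + 1 = s ∧ f (x :: m) ≠ 0 := by
  obtain ⟨w, hw⟩ := Function.ne_iff.mp h0
  have hl : w.length = s := by
    by_contra h
    exact hw (hsupp f hf w h)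
  cases w with
  | nil => simp at hl; omega
  | cons x m => exact ⟨x, m, by simpa using hl, hw⟩

lemma ex_snoc (hs : 2 ≤ s) (hsupp : ∀ f ∈ W, ∀ w : List L, w.length ≠ s → f w = 0)
    {f : List L → k} (hf : f ∈ W) (h0 : f ≠ 0) :
    ∃ m x, m.length + 1 = s ∧ f (m ++ [x]) ≠ 0 := by
  obtain ⟨w, hw⟩ := Function.ne_iff.mp h0
  have hl : w.length = s := by
    by_contra h
    exact hw (hsupp f hf w h)
  rcases List.eq_nil_or_concat w with rfl | ⟨m, x, rfl⟩
  · simp at hl; omega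
  · exact ⟨m, x, by simpa using hl, by simpa using hw⟩

/-- Step 1: all elements of `W` have rank at most one for the splitting `1 | s-1`. -/
lemma rank_le_one (hs : 2 ≤ s) (hsupp : ∀ f ∈ W, ∀ w : List L, w.length ≠ s → f w = 0)
    (hdim : Module.finrank k W = 2)
    (H1 : ∀ a ∈ W, a ≠ 0 → ∃ b ∈ W, b ≠ 0 ∧ Pair W s a b)
    (H2 : ∀ b ∈ W, b ≠ 0 → ∃ a ∈ W, a ≠ 0 ∧ Pair W s a b)
    (a : List L → k) (ha : a ∈ W) (x y : L) (m n : List L) :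
    a (x :: m) * a (y :: n) = a (x :: n) * a (y :: m) := by
  by_cases hm : m.length + 1 = s
  swap
  · rw [hsupp a ha (x :: m) (by simpa using hm), hsupp a ha (y :: m) (by simpa using hm)]; simp
  by_cases hn : n.length + 1 = s
  swap
  · rw [hsupp a ha (x :: n) (by simpa using hn), hsupp a ha (y :: n) (by simpa using hn)]; simp
  by_contra hne
  have ha0 : a ≠ 0 := by rintro rfl; simp at hne
  obtain ⟨b, hb, hb0, hP⟩ := H1 a ha ha0
  obtain ⟨z, q, hq, hz⟩ := ex_cons hs hsupp hb hb0
  obtain ⟨gx, hgx, ex⟩ := hP [x] q (by simp; omega)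
  obtain ⟨gy, hgy, ey⟩ := hP [y] q (by simp; omega)
  have key1 : ∀ g ∈ W, ∀ r : List L, ∀ t : L,
      g (r ++ [t]) * b (z :: q) = g (r ++ [z]) * b (t :: q) := by
    intro g hg r t
    by_cases hr : r.length + 1 = s
    swap
    · rw [hsupp g hg (r ++ [t]) (by simpa using hr), hsupp g hg (r ++ [z]) (by simpa using hr)]
      simp
    obtain ⟨c, d, rfl⟩ := span_two W hdim gx gy hgx hgy (m ++ [z]) (n ++ [z]) (by
      rw [ex m [z] (by omega) (by simp), ey n [z] (by omega) (by simp),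
        ex n [z] (by omega) (by simp), ey m [z] (by omega) (by simp)]
      intro h
      apply hne
      simp only [List.singleton_append] at h
      have h2 : (a (x :: m) * a (y :: n) - a (x :: n) * a (y :: m)) *
        (b (z :: q) * b (z :: q)) = 0 := by linear_combination h
      exact sub_eq_zero.mp ((mul_eq_zero.mp h2).resolve_right (mul_ne_zero hz hz))) g hg
    simp only [Pi.add_apply, Pi.smul_apply, smul_eq_mul]
    rw [ex r [z] (by omega) (by simp), ey r [z] (by omega) (by simp),
        ex r [t] (by omega) (by simp), ey r [t] (by omega) (by simp)]
    simp only [List.singleton_append]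
    ring
  have hrot : W.map rot ≤ W := by
    rintro _ ⟨f, hf, rfl⟩
    by_cases hf0 : f = 0
    · rw [hf0, map_zero]; exact W.zero_mem
    obtain ⟨e, he, he0, hP'⟩ := H2 f hf hf0
    obtain ⟨p, t, hp, ht⟩ := ex_snoc hs hsupp he he0
    obtain ⟨g, hg, eg⟩ := hP' p [z] (by simpa using hp)
    have hpz : e (p ++ [z]) ≠ 0 := by
      intro h
      have := key1 e he p t
      rw [h, zero_mul] at this
      exact (mul_ne_zero ht hz) this
    have : rot f = (e (p ++ [z]))⁻¹ • g := by
      funext w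
      cases w with
      | nil =>
        rw [rot_nil, Pi.smul_apply, hsupp f hf [] (by simp; omega), hsupp g hg [] (by simp; omega)]
        simp
      | cons y r =>
        rw [rot_cons, Pi.smul_apply, smul_eq_mul]
        by_cases hr : r.length + 1 = s
        · have h1 := eg [y] r (by simp) (by omega)
          simp only [List.singleton_append] at h1
          rw [h1, eq_inv_mul_iff_mul_eq₀ hpz]
          have h2 := key1 e he p y
          have h3 := key1 f hf r y
          apply mul_right_cancel₀ hz
          linear_combination e (p ++ [z]) * h3 - f (r ++ [z]) * h2
        · rw [hsupp f hf _ (by simpa using hr), hsupp g hg _ (by simpa using hr)]; simp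
    rw [show rot f = (e (p ++ [z]))⁻¹ • g from this]
    exact W.smul_mem _ hg
  obtain ⟨h, hh, rfl⟩ := (le_map_iff W hdim).mpr hrot ha
  simp only [rot_cons] at hne
  apply hne
  have h1 := key1 h hh m x
  have h2 := key1 h hh n y
  have h3 := key1 h hh n x
  have h4 := key1 h hh m y
  apply mul_right_cancel₀ (mul_ne_zero hz hz)
  linear_combination h1 * (h (n ++ [y]) * b (z :: q)) + h (m ++ [z]) * b (x :: q) * h2
    - h3 * (h (m ++ [y]) * b (z :: q)) - h (n ++ [z]) * b (x :: q) * h4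

/-- Step 2: dichotomy for two-dimensional spaces of rank one matrices. -/
lemma dichotomy (hsupp : ∀ f ∈ W, ∀ w : List L, w.length ≠ s → f w = 0) (hs : 2 ≤ s)
    (hdim : Module.finrank k W = 2)
    (hR : ∀ a ∈ W, ∀ (x y : L) (m n : List L),
      a (x :: m) * a (y :: n) = a (x :: n) * a (y :: m)) :
    (∀ f ∈ W, ∀ g ∈ W, ∀ (x y : L) (m n : List L),
      f (x :: m) * g (y :: n) = f (y :: m) * g (x :: n)) ∨
    (∀ f ∈ W, ∀ g ∈ W, ∀ (x y : L) (m n : List L),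
      f (x :: m) * g (y :: n) = f (x :: n) * g (y :: m)) := by
  obtain ⟨f, hf, g, hg, u, v, huv⟩ := ex_indep W hdim
  have hf0 : f ≠ 0 := by rintro rfl; simp at huv
  have hg0 : g ≠ 0 := by rintro rfl; simp at huv
  have par : ∀ f ∈ W, f ≠ 0 → ∃ (l : L → k) (d : List L → k), ∀ x m, f (x :: m) = l x * d m := by
    intro f hf hf0
    obtain ⟨z, m0, -, hz⟩ := ex_cons hs hsupp hf hf0
    refine ⟨fun x => f (x :: m0), fun m => f (z :: m) / f (z :: m0), fun x m => ?_⟩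
    have := hR f hf x z m m0
    field_simp
    linear_combination this
  obtain ⟨l, d, hld⟩ := par f hf hf0
  obtain ⟨l', d', hld'⟩ := par g hg hg0
  have hpol : ∀ (x y : L) (m n : List L),
      (l x * l' y - l y * l' x) * (d m * d' n - d n * d' m) = 0 := by
    intro x y m n
    have := hR (f + g) (W.add_mem hf hg) x y m n
    simp only [Pi.add_apply, hld, hld'] at this
    linear_combination this
  by_cases hc : ∀ x y, l x * l' y - l y * l' x = 0
  · left
    intro p hp q hq x y m n
    obtain ⟨c1, c2, rfl⟩ := span_two W hdim f g hf hg u v huv p hp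
    obtain ⟨c3, c4, rfl⟩ := span_two W hdim f g hf hg u v huv q hq
    simp only [Pi.add_apply, Pi.smul_apply, smul_eq_mul, hld, hld']
    linear_combination (c1 * c4 * d m * d' n - c2 * c3 * d' m * d n) * hc x y
  · right
    push Not at hc
    obtain ⟨x0, y0, h0⟩ := hc
    have hc' : ∀ m n, d m * d' n - d n * d' m = 0 := fun m n =>
      (mul_eq_zero.mp (hpol x0 y0 m n)).resolve_left h0
    intro p hp q hq x y m n
    obtain ⟨c1, c2, rfl⟩ := span_two W hdim f g hf hg u v huv p hp
    obtain ⟨c3, c4, rfl⟩ := span_two W hdim f g hf hg u v huv q hq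
    simp only [Pi.add_apply, Pi.smul_apply, smul_eq_mul, hld, hld']
    linear_combination (c1 * c4 * l x * l' y - c2 * c3 * l' x * l y) * hc' m n

lemma rot_eq (hs : 2 ≤ s) (hsupp : ∀ f ∈ W, ∀ w : List L, w.length ≠ s → f w = 0)
    {f g : List L → k} (hf : f ∈ W) (hg : g ∈ W) (c : k) (hc : c ≠ 0)
    (h : ∀ y m, m.length + 1 = s → g (m ++ [y]) = c * f (y :: m)) : f ∈ W.map rot := by
  refine ⟨c⁻¹ • g, W.smul_mem _ hg, ?_⟩
  funext w
  cases w with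
  | nil =>
    rw [rot_nil, Pi.smul_apply, hsupp f hf [] (by simp; omega), hsupp g hg [] (by simp; omega)]
    simp
  | cons y r =>
    rw [rot_cons, Pi.smul_apply, smul_eq_mul]
    by_cases hr : r.length + 1 = s
    · rw [h y r hr, inv_mul_cancel_left₀ hc]
    · rw [hsupp f hf _ (by simpa using hr), hsupp g hg _ (by simpa using hr)]; simp

theorem core (hs : 2 ≤ s) (hsupp : ∀ f ∈ W, ∀ w : List L, w.length ≠ s → f w = 0)
    (hdim : Module.finrank k W = 2)
    (H1 : ∀ a ∈ W, a ≠ 0 → ∃ b ∈ W, b ≠ 0 ∧ Pair W s a b)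
    (H2 : ∀ b ∈ W, b ≠ 0 → ∃ a ∈ W, a ≠ 0 ∧ Pair W s a b) : False := by
  have hR := rank_le_one hs hsupp hdim H1 H2
  obtain ⟨f0, hf0, hf00, -⟩ := ex_ker W hdim []
  obtain ⟨z, m0, hm0, hz⟩ := ex_cons hs hsupp hf0 hf00
  rcases dichotomy hsupp hs hdim hR with hD | hD
  · have hrot : W ≤ W.map rot := by
      intro a ha
      by_cases ha0 : a = 0
      · rw [ha0]; exact Submodule.zero_mem _
      obtain ⟨b, hb, hb0, hP⟩ := H1 a ha ha0
      obtain ⟨x, q, hq, hx⟩ := ex_cons hs hsupp hb hb0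
      obtain ⟨g, hg, eg⟩ := hP [x] q (by simp; omega)
      refine rot_eq hs hsupp ha hg _ hx (fun y m hm => ?_)
      rw [eg m [y] (by omega) (by simp)]
      simp only [List.singleton_append]
      rw [hD a ha b hb x y m q, mul_comm]
    have main : ∀ u v : List L, ∀ f ∈ W, f (List.replicate u.length z ++ v) = 0 →
        f (u ++ v) = 0 := by
      intro u
      induction u with
      | nil => intro v f _ h; simpa using h
      | cons x u ih =>
        intro v f hf h
        obtain ⟨g, hg, rfl⟩ := hrot hf
        have h1 : g (List.replicate u.length z ++ (v ++ [z])) = 0 := by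
          simpa [List.replicate_succ, rot_cons] using h
        have h2 := ih _ g hg h1
        have h3 : rot g (z :: (u ++ v)) = 0 := by
          rw [rot_cons]; simpa using h2
        have h4 := hD _ hf f0 hf0 x z (u ++ v) m0
        rw [h3, zero_mul] at h4
        exact (mul_eq_zero.mp h4).resolve_right hz
    obtain ⟨f, hf, hne, hfz⟩ := ex_ker W hdim (List.replicate s z)
    obtain ⟨w, hw⟩ := Function.ne_iff.mp hne
    have hl : w.length = s := by
      by_contra h
      exact hw (hsupp f hf w h)
    apply hw
    have := main w [] f hf (by rw [hl]; simpa using hfz)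
    simpa using this
  · have hrot : W ≤ W.map rot := by
      intro b hb
      by_cases hb0 : b = 0
      · rw [hb0]; exact Submodule.zero_mem _
      obtain ⟨a, ha, ha0, hP⟩ := H2 b hb hb0
      obtain ⟨x, q, hq, hx⟩ := ex_cons hs hsupp ha ha0
      obtain ⟨g, hg, eg⟩ := hP [x] q (by simp; omega)
      refine rot_eq hs hsupp hb hg _ hx (fun y m hm => ?_)
      rw [eg m [y] (by omega) (by simp)]
      simp only [List.singleton_append]
      rw [hD a ha b hb x y m q]
    have hrot' := (le_map_iff W hdim).mp hrot
    cases m0 with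
    | nil => simp at hm0; omega
    | cons m1 m' =>
      obtain ⟨h, hh, hne, hh0⟩ := ex_ker W hdim (m1 :: m1 :: m')
      have hf : rot h ∈ W := hrot' ⟨h, hh, rfl⟩
      -- `h (m1 :: n) = 0` for every `n`
      have e1 : ∀ n, h (m1 :: n) = 0 := by
        intro n
        have := hD h hh f0 hf0 m1 z n (m1 :: m')
        rw [hh0, zero_mul] at this
        exact (mul_eq_zero.mp this).resolve_right hz
      have hf0' : rot h ≠ 0 := by
        intro h0
        exact hne (rot_inj (by rw [h0, map_zero]))
      obtain ⟨x, m, hm, hx⟩ := ex_cons hs hsupp hf hf0'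
      apply hx
      have h2 := hD (rot h) hf f0 hf0 x z m (m1 :: m')
      have h3 : rot h (x :: m1 :: m') = 0 := by
        rw [rot_cons]
        exact e1 _
      rw [h3, zero_mul] at h2
      exact (mul_eq_zero.mp h2).resolve_right hz

end Core

section Bridge

variable {k : Type} [Field k] {V : Type} [AddCommGroup V] [Module k V]
variable (Rel : Submodule k (TensorAlgebra k V))

/-- The image in `Λ` of a word in elements of `V`. -/
def wd (w : List V) : quotAlg Rel := (w.map (fun v => qmap Rel (TensorAlgebra.ι k v))).prod

lemma wd_append (u v : List V) : wd Rel (u ++ v) = wd Rel u * wd Rel v := by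
  simp [wd]

lemma Adeg_eq (n : ℕ) :
    Adeg Rel n = Submodule.map ((qmap Rel).toLinearMap ∘ₗ TensorAlgebra.ι k) ⊤ ^ n := by
  rw [Adeg, gpc, Submodule.map_pow, Submodule.map_comp, LinearMap.range_eq_map]

lemma Adeg_mul (m n : ℕ) : Adeg Rel (m + n) = Adeg Rel m * Adeg Rel n := by
  simp only [Adeg_eq, pow_add]

lemma wd_mem (w : List V) : wd Rel w ∈ Adeg Rel w.length := by
  induction w with
  | nil => simpa [wd, Adeg_eq] using ⟨1, map_one _⟩
  | cons x w ih =>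
    rw [List.length_cons, add_comm, Adeg_mul]
    have : wd Rel (x :: w) = wd Rel [x] * wd Rel w := wd_append Rel [x] w
    rw [this]
    refine Submodule.mul_mem_mul ?_ ih
    rw [Adeg_eq, pow_one]
    exact ⟨x, trivial, by simp [wd]⟩

lemma wd_mem' {n : ℕ} (w : List V) (h : w.length = n) : wd Rel w ∈ Adeg Rel n := h ▸ wd_mem Rel w

lemma Adeg_span (n : ℕ) : Adeg Rel n = Submodule.span k (wd Rel '' {w | w.length = n}) := by
  apply le_antisymm
  · induction n with
    | zero =>
      rw [Adeg_eq, pow_zero, Submodule.one_eq_span, Submodule.span_le]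
      rintro _ rfl
      exact Submodule.subset_span ⟨[], rfl, by simp [wd]⟩
    | succ n ih =>
      rw [add_comm, Adeg_mul, Submodule.mul_le]
      intro a ha b hb
      have hb' := ih hb
      rw [Adeg_eq, pow_one] at ha
      obtain ⟨x, -, rfl⟩ := ha
      clear hb
      induction hb' using Submodule.span_induction with
      | mem y hy =>
        obtain ⟨w, hw, rfl⟩ := hy
        exact Submodule.subset_span ⟨x :: w, by simp at hw ⊢; omega, by simp [wd]⟩
      | zero => simp
      | add y z _ _ hy hz => rw [mul_add]; exact Submodule.add_mem _ hy hz
      | smul c y _ hy => rw [mul_smul_comm]; exact Submodule.smul_mem _ _ hy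
  · rw [Submodule.span_le]
    rintro _ ⟨w, hw, rfl⟩
    exact wd_mem' Rel w hw

lemma dual_ext {n : ℕ} (φ : Adeg Rel n →ₗ[k] k)
    (h : ∀ w (hw : w.length = n), φ ⟨wd Rel w, wd_mem' Rel w hw⟩ = 0) : φ = 0 := by
  obtain ⟨F, hF⟩ := LinearMap.exists_extend φ
  have hF' : ∀ x : Adeg Rel n, φ x = F x := fun x => by rw [← hF]; rfl
  have : Adeg Rel n ≤ LinearMap.ker F := by
    rw [Adeg_span, Submodule.span_le]
    rintro _ ⟨w, hw, rfl⟩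
    have := h w hw
    rw [hF'] at this
    exact this
  ext x
  rw [hF']
  exact this x.2

/-- A functional on `Λ_s` as a function on words. -/
def Th (s : ℕ) : (Adeg Rel s →ₗ[k] k) →ₗ[k] (List V → k) where
  toFun φ w := if h : w.length = s then φ ⟨wd Rel w, wd_mem' Rel w h⟩ else 0
  map_add' φ ψ := by
    funext w
    by_cases h : w.length = s <;> simp [h]
  map_smul' c φ := by
    funext w
    by_cases h : w.length = s <;> simp [h]

lemma Th_apply {s : ℕ} (φ : Adeg Rel s →ₗ[k] k) (w : List V) (h : w.length = s) :
    Th Rel s φ w = φ ⟨wd Rel w, wd_mem' Rel w h⟩ := by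
  simp [Th, h]

lemma Th_inj (s : ℕ) : Function.Injective (Th Rel s) := by
  rw [injective_iff_map_eq_zero]
  intro φ h
  apply dual_ext
  intro w hw
  rw [← Th_apply Rel φ w hw, h]; rfl

/-- Multiplication `Λ_s × Λ_s → Λ_{2s}`. -/
def mu (s : ℕ) : Adeg Rel s →ₗ[k] Adeg Rel s →ₗ[k] Adeg Rel (2 * s) :=
  LinearMap.mk₂ k (fun p q => ⟨p.1 * q.1, by
      rw [two_mul, Adeg_mul]; exact Submodule.mul_mem_mul p.2 q.2⟩)
    (by intros; ext; simp [add_mul]) (by intros; ext; simp)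
    (by intros; ext; simp [mul_add]) (by intros; ext; simp)

/-- Functionals on `Λ_{2s}` as bilinear forms on `Λ_s`. -/
def J (s : ℕ) : (Adeg Rel (2 * s) →ₗ[k] k) →ₗ[k] (Adeg Rel s →ₗ[k] Adeg Rel s →ₗ[k] k) where
  toFun F := (mu Rel s).compr₂ F
  map_add' _ _ := by ext; simp
  map_smul' _ _ := by ext; simp

lemma J_apply (s : ℕ) (F : Adeg Rel (2 * s) →ₗ[k] k) (p q : Adeg Rel s) :
    J Rel s F p q = F (mu Rel s p q) := rfl

lemma J_inj (s : ℕ) : Function.Injective (J Rel s) := by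
  rw [injective_iff_map_eq_zero]
  intro F h
  apply dual_ext
  intro w hw
  have h1 : (w.take s).length = s := by simp; omega
  have h2 : (w.drop s).length = s := by simp; omega
  have := J_apply Rel s F ⟨_, wd_mem' Rel _ h1⟩ ⟨_, wd_mem' Rel _ h2⟩
  rw [h] at this
  simp only [LinearMap.zero_apply] at this
  rw [this]
  congr 1
  apply Subtype.ext
  change wd Rel w = wd Rel (w.take s) * wd Rel (w.drop s)
  rw [← wd_append, List.take_append_drop]

instance freeA (n : ℕ) : Module.Free k (Adeg Rel n) := by
  let : AddCommGroup (Adeg Rel n) := Module.addCommMonoidToAddCommGroup k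
  exact Module.Free.of_divisionRing k (Adeg Rel n)

lemma inter_abs {E E2 : Type} [AddCommGroup E] [Module k E] [AddCommGroup E2] [Module k E2]
    (h2 : Module.finrank k E = 2) (h3 : 3 ≤ Module.finrank k E2)
    (j : (E2 →ₗ[k] k) →ₗ[k] (E →ₗ[k] E →ₗ[k] k)) (hj : Function.Injective j)
    (T : (E →ₗ[k] k) →ₗ[k] (E →ₗ[k] E →ₗ[k] k)) (hT : Function.Injective T) :
    ∃ ψ ≠ 0, ∃ F, j F = T ψ := by
  have : FiniteDimensional k E := FiniteDimensional.of_finrank_pos (by omega)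
  have : FiniteDimensional k E2 := FiniteDimensional.of_finrank_pos (by omega)
  have e1 := LinearMap.finrank_range_of_inj hj
  have e2 := LinearMap.finrank_range_of_inj hT
  have e3 := Submodule.finrank_sup_add_finrank_inf_eq (K := k)
    (V := E →ₗ[k] E →ₗ[k] k) (LinearMap.range j) (LinearMap.range T)
  have e4 := Submodule.finrank_le (LinearMap.range j ⊔ LinearMap.range T)
  simp only [Module.finrank_linearMap, Module.finrank_self, h2] at e1 e2 e4
  have hne : LinearMap.range j ⊓ LinearMap.range T ≠ ⊥ := by
    intro hb
    rw [hb, finrank_bot] at e3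
    omega
  obtain ⟨B, hB, hB0⟩ := Submodule.exists_mem_ne_zero_of_ne_bot hne
  obtain ⟨⟨F, hF⟩, ⟨ψ, rfl⟩⟩ := hB
  exact ⟨ψ, by rintro rfl; simp at hB0, F, hF⟩

lemma inter (s : ℕ) (h2 : Module.finrank k (Adeg Rel s) = 2)
    (h3 : 3 ≤ Module.finrank k (Adeg Rel (2 * s)))
    (T : (Adeg Rel s →ₗ[k] k) →ₗ[k] (Adeg Rel s →ₗ[k] Adeg Rel s →ₗ[k] k))
    (hT : Function.Injective T) :
    ∃ ψ ≠ 0, ∃ F, J Rel s F = T ψ := by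
  let i1 : AddCommGroup (Adeg Rel s) := Module.addCommMonoidToAddCommGroup k
  let i2 : AddCommGroup (Adeg Rel (2 * s)) := Module.addCommMonoidToAddCommGroup k
  exact @inter_abs k _ (Adeg Rel s) (Adeg Rel (2 * s)) i1 _ i2 _ h2 h3 (J Rel s) (J_inj Rel s) T hT

lemma pair_of (s : ℕ) (φ ψ : Adeg Rel s →ₗ[k] k) (F : Adeg Rel (2 * s) →ₗ[k] k)
    (h : ∀ p q, F (mu Rel s p q) = φ p * ψ q) :
    Pair (LinearMap.range (Th Rel s)) s (Th Rel s φ) (Th Rel s ψ) := by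
  intro p q hpq
  obtain ⟨G, hG⟩ := LinearMap.exists_extend F
  have hG' : ∀ x : Adeg Rel (2 * s), F x = G x := fun x => by rw [← hG]; rfl
  let g : Adeg Rel s →ₗ[k] k :=
    G ∘ₗ LinearMap.mulLeft k (wd Rel p) ∘ₗ LinearMap.mulRight k (wd Rel q) ∘ₗ (Adeg Rel s).subtype
  refine ⟨Th Rel s g, ⟨g, rfl⟩, fun m n hm hn => ?_⟩
  rw [Th_apply Rel g (m ++ n) (by simp; omega), Th_apply Rel φ (p ++ m) (by simp; omega),
    Th_apply Rel ψ (n ++ q) (by simp; omega), ← h, hG']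
  change G (wd Rel p * (wd Rel (m ++ n) * wd Rel q)) = G (wd Rel (p ++ m) * wd Rel (n ++ q))
  simp only [wd_append, mul_assoc]

end Bridge

end SHomogAux

/-- Let `k` be an algebraically closed field, `s ≥ 2`, and let
`Λ = T(V)/(Rel)` be an `s`-homogeneous `k`-algebra (so `V` is a finite-dimensional
`k`-vector space and `Rel ⊆ V^{⊗s}`). If `dim_k Λ_s = 2`, then `dim_k Λ_{2s} ≤ 2`. -/
theorem stmt_0 (k : Type) [Field k] [IsAlgClosed k]
    (V : Type) [AddCommGroup V] [Module k V] [FiniteDimensional k V]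
    (s : ℕ) (hs : 2 ≤ s)
    (Rel : Submodule k (TensorAlgebra k V)) (hRel : Rel ≤ gpc k V s)
    (h2 : finrank k (Adeg Rel s) = 2) :
    finrank k (Adeg Rel (2 * s)) ≤ 2 := by
  by_contra hcon
  have h3 : 3 ≤ finrank k (Adeg Rel (2 * s)) := by omega
  have : Module.Finite k (Adeg Rel s) := Module.finite_of_finrank_pos (by omega)
  refine SHomogAux.core (W := LinearMap.range (SHomogAux.Th Rel s)) hs ?_ ?_ ?_ ?_
  · rintro _ ⟨φ, rfl⟩ w hw
    simp [SHomogAux.Th, hw]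
  · rw [LinearMap.finrank_range_of_inj (SHomogAux.Th_inj Rel s)]
    exact (Module.finrank_linearMap_self k k (Adeg Rel s)).trans h2
  · rintro _ ⟨φ, rfl⟩ h0
    have hφ : φ ≠ 0 := by rintro rfl; simp at h0
    obtain ⟨x, hx⟩ : ∃ x, φ x ≠ 0 := by
      by_contra hc
      push Not at hc
      exact hφ (LinearMap.ext hc)
    let T : (Adeg Rel s →ₗ[k] k) →ₗ[k] (Adeg Rel s →ₗ[k] Adeg Rel s →ₗ[k] k) :=
      { toFun := fun ψ => φ.smulRight ψ
        map_add' := by intros; ext; simp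
        map_smul' := by intros; ext; simp; ring }
    have hTa : ∀ ψ p q, T ψ p q = φ p * ψ q := fun ψ p q => rfl
    obtain ⟨ψ, hψ, F, hF⟩ := SHomogAux.inter Rel s h2 h3 T (by
      rw [injective_iff_map_eq_zero]
      intro ψ hψ
      ext q
      have := hTa ψ x q
      rw [hψ] at this
      exact (mul_eq_zero.mp this.symm).resolve_left hx)
    refine ⟨_, ⟨ψ, rfl⟩, ?_, SHomogAux.pair_of Rel s φ ψ F ?_⟩
    · intro h; exact hψ (SHomogAux.Th_inj Rel s (by rw [h, map_zero]))
    · intro p q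
      rw [← SHomogAux.J_apply, hF, hTa]
  · rintro _ ⟨φ, rfl⟩ h0
    have hφ : φ ≠ 0 := by rintro rfl; simp at h0
    obtain ⟨x, hx⟩ : ∃ x, φ x ≠ 0 := by
      by_contra hc
      push Not at hc
      exact hφ (LinearMap.ext hc)
    let T : (Adeg Rel s →ₗ[k] k) →ₗ[k] (Adeg Rel s →ₗ[k] Adeg Rel s →ₗ[k] k) :=
      { toFun := fun ψ => ψ.smulRight φ
        map_add' := by intros; ext; simp [add_mul]
        map_smul' := by intros; ext; simp; ring }
    have hTa : ∀ ψ p q, T ψ p q = ψ p * φ q := fun ψ p q => rfl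
    obtain ⟨ψ, hψ, F, hF⟩ := SHomogAux.inter Rel s h2 h3 T (by
      rw [injective_iff_map_eq_zero]
      intro ψ hψ
      ext q
      have := hTa ψ q x
      rw [hψ] at this
      exact (mul_eq_zero.mp this.symm).resolve_right hx)
    refine ⟨_, ⟨ψ, rfl⟩, ?_, SHomogAux.pair_of Rel s ψ φ F ?_⟩
    · intro h; exact hψ (SHomogAux.Th_inj Rel s (by rw [h, map_zero]))
    · intro p q
      rw [← SHomogAux.J_apply, hF, hTa]
end
end

section
/- Let k be a field, s ≥ 2, and let Λ = T(V)/(Rel) and Γ = T(V')/(Rel') be s-homogeneous k-algebras. Suppose there exist a graded k-algebra isomorphism θ: Λ^(s) → Γ^(s) between the s-th Veronese rings and a k-linear bijection g: ⊕_{n≥0} Λ_{ns+1} → ⊕_{n≥0} Γ_{ns+1} with g(Λ_{ns+1}) = Γ_{ns+1} for all n ≥ 0, such that g(a·x·b) = θ(a)·g(x)·θ(b) for all a ∈ Λ_{ps}, x ∈ Λ_{ns+1}, b ∈ Λ_{qs} and all p, n, q ≥ 0 (products taken in Λ and in Γ). If there is no nonzero element a ∈ Λ_s with a·Λ_s = Λ_s·a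 = 0 in Λ (equivalently, if the Λ^(s)-bimodule ⊕_{n≥1} Λ_{ns} has no nonzero direct summand concentrated in its lowest degree), then Λ and Γ are isomorphic as graded k-algebras. -/
/-! Core definitions for s-homogeneous algebras Λ = T(V)/(Rel). -/

open TensorAlgebra Submodule Module
open scoped TensorProduct

noncomputable section

namespace SHomog

variable {k : Type} [Field k] {V : Type} [AddCommGroup V] [Module k V]

theorem gpc_mul {m n : ℕ} {a b : TensorAlgebra k V} (ha : a ∈ gpc k V m) (hb : b ∈ gpc k V n) :
    a * b ∈ gpc k V (m + n) := by
  unfold gpc at *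
  rw [pow_add]
  exact Submodule.mul_mem_mul ha hb

theorem gpc_map_le {A : Type} [Ring A] [Algebra k A] (F : TensorAlgebra k V →ₐ[k] A) (n : ℕ) :
    (gpc k V n).map F.toLinearMap = ((gpc k V 1).map F.toLinearMap) ^ n := by
  unfold gpc
  rw [pow_one, Submodule.map_pow]

theorem Adeg_eq_pow (Rel : Submodule k (TensorAlgebra k V)) (n : ℕ) :
    Adeg Rel n = (Adeg Rel 1) ^ n := gpc_map_le _ n

/-- Sliding `θ` across a product. -/
theorem slide {B : Type} [Ring B] [Algebra k B] (s : ℕ)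
    (T : TensorAlgebra k V →ₗ[k] B) (F : TensorAlgebra k V →ₐ[k] B)
    (base : ∀ v ∈ gpc k V 1, ∀ w ∈ gpc k V 1, ∀ t ∈ gpc k V (s - 1),
      T (v * t) * F w = F v * T (t * w)) (i : ℕ) :
    i ≤ s → ∀ a ∈ gpc k V i, ∀ c ∈ gpc k V i, ∀ m ∈ gpc k V (s - i),
      T (a * m) * F c = F a * T (m * c) := by
  induction i with
  | zero =>
    intro _ a ha c hc m _
    simp only [gpc, pow_zero, Submodule.mem_one] at ha hc
    obtain ⟨x, rfl⟩ := ha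
    obtain ⟨y, rfl⟩ := hc
    simp only [AlgHom.commutes, ← Algebra.commutes y, ← Algebra.smul_def, map_smul, smul_comm x y]
  | succ i ih =>
    intro hi a ha c hc m hm
    have ha' : a ∈ gpc k V i * gpc k V 1 := by
      unfold gpc at *; rwa [pow_one, ← pow_succ]
    have hc' : c ∈ gpc k V i * gpc k V 1 := by
      unfold gpc at *; rwa [pow_one, ← pow_succ]
    induction ha' using Submodule.mul_induction_on' with
    | mem_mul_mem a ha1 v hv =>
      induction hc' using Submodule.mul_induction_on' with
      | mem_mul_mem c hc1 w hw =>
        have h1 := ih (by omega) a ha1 c hc1 (v * m)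
          (by have := gpc_mul hv hm; rwa [show 1 + (s - (i + 1)) = s - i by omega] at this)
        have h2 := base v hv w hw (m * c)
          (by have := gpc_mul hm hc1; rwa [show s - (i + 1) + i = s - 1 by omega] at this)
        rw [map_mul F, map_mul F, ← mul_assoc (T _), mul_assoc a v m, h1, mul_assoc (F a),
          mul_assoc v m c, h2, ← mul_assoc (F a), mul_assoc m c w]
      | add x hx y hy h1 h2 =>
        have e : ∀ z ∈ gpc k V i * gpc k V 1, z ∈ gpc k V (i + 1) := by
          intro z hz; unfold gpc at *; rwa [pow_one, ← pow_succ] at hz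
        rw [map_add, mul_add, mul_add, map_add, mul_add, h1 (e _ hx), h2 (e _ hy)]
    | add x hx y hy h1 h2 =>
      have e : ∀ z ∈ gpc k V i * gpc k V 1, z ∈ gpc k V (i + 1) := by
        intro z hz; unfold gpc at *; rwa [pow_one, ← pow_succ] at hz
      rw [map_add, add_mul, add_mul, map_add, add_mul, h1 (e _ hx), h2 (e _ hy)]

end SHomog

open SHomog Module

/-- Let `k` be a field, `s ≥ 2`, and let `Λ = T(V)/(Rel)` and
`Γ = T(V')/(Rel')` be `s`-homogeneous `k`-algebras. Suppose there is a graded `k`-algebra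
isomorphism `θ` between the `s`-th Veronese rings (encoded as a `k`-linear map
`θ : Λ → Γ` which is unital, multiplicative on Veronese components, carries `Λ_{ns}` onto
`Γ_{ns}`, and is injective on `⊕_n Λ_{ns}`), and a `k`-linear bijection
`g : ⊕_n Λ_{ns+1} → ⊕_n Γ_{ns+1}` (encoded likewise) with `g(Λ_{ns+1}) = Γ_{ns+1}` and
`g(a·x·b) = θ(a)·g(x)·θ(b)` for Veronese-homogeneous `a, b` and `x ∈ Λ_{ns+1}`.
If there is no nonzero `a ∈ Λ_s` with `a·Λ_s = Λ_s·a = 0`, then `Λ ≅ Γ` as graded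
`k`-algebras. -/
theorem stmt_11 (k : Type) [Field k]
    (V : Type) [AddCommGroup V] [Module k V] [FiniteDimensional k V]
    (V' : Type) [AddCommGroup V'] [Module k V'] [FiniteDimensional k V']
    (s : ℕ) (hs : 2 ≤ s)
    (Rel : Submodule k (TensorAlgebra k V)) (hRel : Rel ≤ gpc k V s)
    (Rel' : Submodule k (TensorAlgebra k V')) (hRel' : Rel' ≤ gpc k V' s)
    (θ : quotAlg Rel →ₗ[k] quotAlg Rel')
    (hθone : θ 1 = 1)
    (hθmul : ∀ (p q : ℕ) (a b : quotAlg Rel),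
      a ∈ Adeg Rel (p * s) → b ∈ Adeg Rel (q * s) → θ (a * b) = θ a * θ b)
    (hθcomp : ∀ n : ℕ, (Adeg Rel (n * s)).map θ = Adeg Rel' (n * s))
    (hθinj : ∀ x ∈ ⨆ n : ℕ, Adeg Rel (n * s), θ x = 0 → x = 0)
    (g : quotAlg Rel →ₗ[k] quotAlg Rel')
    (hgcomp : ∀ n : ℕ, (Adeg Rel (n * s + 1)).map g = Adeg Rel' (n * s + 1))
    (hginj : ∀ x ∈ ⨆ n : ℕ, Adeg Rel (n * s + 1), g x = 0 → x = 0)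
    (hgbi : ∀ (p n q : ℕ) (a x b : quotAlg Rel),
      a ∈ Adeg Rel (p * s) → x ∈ Adeg Rel (n * s + 1) → b ∈ Adeg Rel (q * s) →
        g (a * x * b) = θ a * g x * θ b)
    (hNoSummand : ∀ a ∈ Adeg Rel s,
      (∀ b ∈ Adeg Rel s, a * b = 0 ∧ b * a = 0) → a = 0) :
    ∃ e : quotAlg Rel ≃ₐ[k] quotAlg Rel',
      ∀ n : ℕ, (Adeg Rel n).map e.toLinearMap = Adeg Rel' n := by
  have hA1 : ∀ v, qmap Rel (ι k v) ∈ Adeg Rel 1 := fun v =>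
    Submodule.mem_map_of_mem (by simp [gpc])
  have hA1' : ∀ v, qmap Rel' (ι k v) ∈ Adeg Rel' 1 := fun v =>
    Submodule.mem_map_of_mem (by simp [gpc])
  have hA1e : ∀ x ∈ Adeg Rel' 1, ∃ v, qmap Rel' (ι k v) = x := by
    rintro x ⟨y, hy, rfl⟩
    simp only [gpc, pow_one] at hy
    obtain ⟨v, rfl⟩ := hy
    exact ⟨v, rfl⟩
  have h1A : (1 : quotAlg Rel) ∈ Adeg Rel (0 * s) := by
    rw [zero_mul, Adeg_eq_pow, pow_zero]; exact Submodule.one_le.mp le_rfl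
  have hg1 : (Adeg Rel 1).map g = Adeg Rel' 1 := by simpa using hgcomp 0
  have hginj1 : ∀ x ∈ Adeg Rel 1, g x = 0 → x = 0 := fun x hx =>
    hginj x (Submodule.mem_iSup_of_mem 0 (by simpa using hx))
  have hθs : (Adeg Rel s).map θ = Adeg Rel' s := by simpa using hθcomp 1
  have hθinjn : ∀ n, ∀ x ∈ Adeg Rel (n * s), θ x = 0 → x = 0 := fun n x hx =>
    hθinj x (Submodule.mem_iSup_of_mem n hx)
  have hmul : ∀ m n, ∀ a ∈ Adeg Rel m, ∀ b ∈ Adeg Rel n, a * b ∈ Adeg Rel (m + n) := by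
    intro m n a ha b hb
    rw [Adeg_eq_pow] at ha hb ⊢
    rw [pow_add]; exact Submodule.mul_mem_mul ha hb
  have key : ∀ a ∈ Adeg Rel s, (∀ b ∈ Adeg Rel s, θ a * θ b = 0 ∧ θ b * θ a = 0) → a = 0 := by
    intro a ha h
    refine hNoSummand a ha fun b hb => ?_
    have ha' : a ∈ Adeg Rel (1 * s) := by simpa using ha
    have hb' : b ∈ Adeg Rel (1 * s) := by simpa using hb
    constructor
    · refine hθinjn 2 _ ?_ ?_
      · rw [two_mul]; exact hmul _ _ _ ha _ hb
      · rw [hθmul 1 1 _ _ ha' hb']; exact (h b hb).1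
    · refine hθinjn 2 _ ?_ ?_
      · rw [two_mul]; exact hmul _ _ _ hb _ ha
      · rw [hθmul 1 1 _ _ hb' ha']; exact (h b hb).2
  let F : TensorAlgebra k V →ₐ[k] quotAlg Rel' :=
    TensorAlgebra.lift k (g ∘ₗ (qmap Rel).toLinearMap ∘ₗ ι k)
  have hFι : ∀ v, F (ι k v) = g (qmap Rel (ι k v)) := fun v => by simp [F]
  have hF1 : ∀ v ∈ gpc k V 1, F v = g (qmap Rel v) := by
    intro v hv
    simp only [gpc, pow_one] at hv
    obtain ⟨v, rfl⟩ := hv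
    exact hFι v
  have hFmap : ∀ n, (gpc k V n).map F.toLinearMap = Adeg Rel' n := by
    intro n
    rw [gpc_map_le, Adeg_eq_pow, ← hg1]
    congr 1
    ext x
    simp only [Adeg, Submodule.mem_map]
    constructor
    · rintro ⟨y, hy, rfl⟩
      exact ⟨_, ⟨y, hy, rfl⟩, (hF1 y hy).symm⟩
    · rintro ⟨_, ⟨y, hy, rfl⟩, rfl⟩
      exact ⟨y, hy, hF1 y hy⟩
  have hq : ∀ n, ∀ t ∈ gpc k V n, qmap Rel t ∈ Adeg Rel n := fun n t ht =>
    Submodule.mem_map_of_mem (f := (qmap Rel).toLinearMap) ht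
  have slide' : ∀ a ∈ gpc k V s, ∀ c ∈ gpc k V s,
      θ (qmap Rel a) * F c = F a * θ (qmap Rel c) := by
    intro a ha c hc
    have := slide s (θ ∘ₗ (qmap Rel).toLinearMap) F ?_ s le_rfl a ha c hc 1
      (by simp only [gpc, tsub_self, pow_zero]; exact Submodule.one_le.mp le_rfl)
    · simpa using this
    · intro v hv w hw t ht
      have e1 := hgbi 1 0 0 (qmap Rel (v * t)) (qmap Rel w) 1
        (by have := hq _ _ (gpc_mul hv ht)
            rwa [show 1 + (s - 1) = 1 * s by omega] at this)
        (by simpa using hq _ _ hw) h1A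
      have e2 := hgbi 0 0 1 1 (qmap Rel v) (qmap Rel (t * w)) h1A
        (by simpa using hq _ _ hv)
        (by have := hq _ _ (gpc_mul ht hw)
            rwa [show (s - 1) + 1 = 1 * s by omega] at this)
      simp only [hθone, one_mul, mul_one] at e1 e2
      simp only [LinearMap.comp_apply, AlgHom.toLinearMap_apply, hF1 v hv, hF1 w hw]
      rw [← e1, ← e2, ← map_mul, ← map_mul, mul_assoc]
  have kerF : ∀ r ∈ gpc k V s, qmap Rel r = 0 → F r = 0 := by
    intro r hr h0
    have hm : F r ∈ (Adeg Rel s).map θ := by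
      rw [hθs, ← hFmap]; exact Submodule.mem_map_of_mem (f := F.toLinearMap) hr
    obtain ⟨a, ha, hra⟩ := hm
    have : a = 0 := by
      refine key a ha ?_
      rintro _ ⟨w, hw, rfl⟩
      have e1 := slide' r hr w hw
      have e2 := slide' w hw r hr
      rw [h0, map_zero, zero_mul] at e1
      rw [h0, map_zero, mul_zero] at e2
      rw [hra]
      exact ⟨e1.symm, e2⟩
    rw [← hra, this, map_zero]
  have kerq : ∀ r ∈ gpc k V s, F r = 0 → qmap Rel r = 0 := by
    intro r hr h0
    refine key _ (hq _ _ hr) fun b hb => ?_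
    have hb' : θ b ∈ (gpc k V s).map F.toLinearMap := by
      rw [hFmap, ← hθs]; exact Submodule.mem_map_of_mem hb
    obtain ⟨w, hw, hwb⟩ := hb'
    rw [← hwb]
    have e1 := slide' r hr w hw
    have e2 := slide' w hw r hr
    rw [h0, zero_mul] at e1
    rw [h0, mul_zero] at e2
    exact ⟨e1, e2.symm⟩
  have hq0 : ∀ r ∈ Rel, qmap Rel r = 0 := by
    intro r hr
    have := RingQuot.mkAlgHom_rel k (s := fun x y : TensorAlgebra k V => x ∈ Rel ∧ y = 0)
      (x := r) (y := 0) ⟨hr, rfl⟩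
    rwa [map_zero] at this
  have hq0' : ∀ r ∈ Rel', qmap Rel' r = 0 := by
    intro r hr
    have := RingQuot.mkAlgHom_rel k (s := fun x y : TensorAlgebra k V' => x ∈ Rel' ∧ y = 0)
      (x := r) (y := 0) ⟨hr, rfl⟩
    rwa [map_zero] at this
  let f : quotAlg Rel →ₐ[k] quotAlg Rel' := RingQuot.liftAlgHom k ⟨F, by
    rintro x y ⟨hx, rfl⟩
    rw [map_zero]
    exact kerF x (hRel hx) (hq0 x hx)⟩
  have hf : ∀ t, f (qmap Rel t) = F t := fun t => RingQuot.liftAlgHom_mkAlgHom_apply ..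
  have hfg : ∀ x ∈ Adeg Rel 1, f x = g x := by
    rintro _ ⟨v, hv, rfl⟩
    exact (hf v).trans (hF1 v hv)
  let g1 : Adeg Rel 1 →ₗ[k] Adeg Rel' 1 := g.restrict fun x hx => by
    rw [← hg1]; exact Submodule.mem_map_of_mem hx
  have hg1b : Function.Bijective g1 := by
    constructor
    · rw [injective_iff_map_eq_zero]
      intro x hx
      exact Subtype.ext (hginj1 x x.2 (congrArg Subtype.val hx))
    · rintro ⟨y, hy⟩
      rw [← hg1] at hy
      obtain ⟨x, hx, rfl⟩ := hy
      exact ⟨⟨x, hx⟩, rfl⟩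
  let ge := LinearEquiv.ofBijective g1 hg1b
  let qi : V' →ₗ[k] Adeg Rel' 1 := ((qmap Rel').toLinearMap ∘ₗ ι k).codRestrict _ hA1'
  let ℓ : V' →ₗ[k] quotAlg Rel := (Adeg Rel 1).subtype ∘ₗ ge.symm.toLinearMap ∘ₗ qi
  have hℓm : ∀ v, ℓ v ∈ Adeg Rel 1 := fun v => (ge.symm (qi v)).2
  have hgℓ : ∀ v, g (ℓ v) = qmap Rel' (ι k v) := fun v =>
    congrArg Subtype.val (ge.apply_symm_apply (qi v))
  let H : TensorAlgebra k V' →ₐ[k] quotAlg Rel := TensorAlgebra.lift k ℓ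
  have hHι : ∀ v, H (ι k v) = ℓ v := fun v => by simp [H]
  have hfH : ∀ t, f (H t) = qmap Rel' t := by
    intro t
    have : f.comp H = qmap Rel' := by
      apply TensorAlgebra.hom_ext
      ext v
      change f (H (ι k v)) = qmap Rel' (ι k v)
      rw [hHι, hfg _ (hℓm v), hgℓ]
    exact DFunLike.congr_fun this t
  have hHm : ∀ n, (gpc k V' n).map H.toLinearMap ≤ Adeg Rel n := by
    intro n
    rw [gpc_map_le, Adeg_eq_pow]
    refine pow_le_pow_left' ?_ n
    rintro _ ⟨y, hy, rfl⟩
    simp only [gpc, pow_one] at hy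
    obtain ⟨v, rfl⟩ := hy
    change H (ι k v) ∈ _
    rw [hHι]; exact hℓm v
  have kerH : ∀ r ∈ Rel', H r = 0 := by
    intro r hr
    obtain ⟨t, ht, htr⟩ := hHm s (Submodule.mem_map_of_mem (f := H.toLinearMap) (hRel' hr))
    change qmap Rel t = H r at htr
    rw [← htr]
    apply kerq t ht
    rw [← hf, htr, hfH, hq0' r hr]
  let h : quotAlg Rel' →ₐ[k] quotAlg Rel := RingQuot.liftAlgHom k ⟨H, by
    rintro x y ⟨hx, rfl⟩
    rw [map_zero]
    exact kerH x hx⟩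
  have hh : ∀ t, h (qmap Rel' t) = H t := fun t => RingQuot.liftAlgHom_mkAlgHom_apply ..
  have hfh : f.comp h = AlgHom.id k _ := by
    apply RingQuot.ringQuot_ext'
    apply AlgHom.ext
    intro t
    change f (h (qmap Rel' t)) = qmap Rel' t
    rw [hh, hfH]
  have hhf : h.comp f = AlgHom.id k _ := by
    apply RingQuot.ringQuot_ext'
    apply TensorAlgebra.hom_ext
    ext v
    change h (f (qmap Rel (ι k v))) = qmap Rel (ι k v)
    rw [hfg _ (hA1 v)]
    obtain ⟨v', hv'⟩ := hA1e (g (qmap Rel (ι k v)))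
      (by rw [← hg1]; exact Submodule.mem_map_of_mem (hA1 v))
    rw [← hv', hh, hHι, ← sub_eq_zero]
    apply hginj1 _ (Submodule.sub_mem _ (hℓm v') (hA1 v))
    rw [map_sub, hgℓ, hv', sub_self]
  refine ⟨AlgEquiv.ofAlgHom f h hfh hhf, fun n => ?_⟩
  rw [← hFmap n, Adeg, ← Submodule.map_comp]
  congr 1
  ext t
  exact hf _
end
end
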